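/- Let f : ℝ×ℝ → ℂ be continuous, 2π-periodic in its first variable and even, and suppose there exist ε > 0 and positive constants C_n (n ∈ ℤ) such that |F_0(t)| ≤ C_0 and |F_n(t)| ≤ C_n |t|^{|n|−1} for n ≠ 0, whenever |t| < ε. Then for every n ∈ ℤ and every t > 0, the integral ∫₀^t G_n(arctan x) · T_{|n|}(t/x) · x / √(t²−x²) dx converges absolutely and (−1)^{|n|} ∫₀^t G_n(arctan x) · T_{|n|}(t/x) · x / √(t²−x²) dx = ∫₀^t F_n(u) du. -/

import Mathlib

open MeasureTheory Real Filter Set Topology ENNReal NNReal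

/-- Parametric Radon transform on the cylinder:
`Rf(θ,ρ) = (1/(2π)) ∫₀^{2π} f(s, −tan ρ · cos(θ−s)) ds`. -/
noncomputable def RT (f : ℝ → ℝ → ℂ) (θ ρ : ℝ) : ℂ :=
  (1 / (2 * π)) * ∫ s in (0:ℝ)..(2 * π), f s (-Real.tan ρ * Real.cos (θ - s))

/-- `n`-th Fourier coefficient of a function on the cylinder (in the angular variable). -/
noncomputable def Fc (f : ℝ → ℝ → ℂ) (n : ℤ) (t : ℝ) : ℂ :=
  (1 / (2 * π)) * ∫ s in (0:ℝ)..(2 * π), f s t * Complex.exp (-Complex.I * n * s)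

/-- `n`-th Fourier coefficient of `Rf` (in the variable θ). -/
noncomputable def Gc (f : ℝ → ℝ → ℂ) (n : ℤ) (ρ : ℝ) : ℂ :=
  (1 / (2 * π)) * ∫ θ in (0:ℝ)..(2 * π), RT f θ ρ * Complex.exp (-Complex.I * n * θ)

theorem continuous_Fc {f : ℝ → ℝ → ℂ} (hcont : Continuous (Function.uncurry f)) (n : ℤ) :
    Continuous (Fc f n) := by
  unfold Fc
  refine continuous_const.mul
    (intervalIntegral.continuous_parametric_intervalIntegral_of_continuous' ?_ _ _)
  have : Continuous fun p : ℝ × ℝ => f p.2 p.1 := hcont.comp continuous_swap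
  unfold Function.uncurry
  fun_prop

theorem exp_neg_int_mul_add_two_pi (n : ℤ) (s : ℝ) :
    Complex.exp (-Complex.I * n * ((s + 2 * π : ℝ) : ℂ)) = Complex.exp (-Complex.I * n * s) := by
  have h : -Complex.I * n * ((s + 2 * π : ℝ) : ℂ) =
      -Complex.I * n * s + ((-n : ℤ) : ℂ) * (2 * π * Complex.I) := by
    push_cast; ring
  rw [h, Complex.exp_add, Complex.exp_int_mul_two_pi_mul_I, mul_one]

theorem neg_one_pow_natAbs_eq_zpow (n : ℤ) : (-1 : ℂ) ^ n.natAbs = (-1) ^ n := by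
  rcases Int.natAbs_eq n with h | h
  · conv_rhs => rw [h]
    rw [zpow_natCast]
  · conv_rhs => rw [h]
    rw [zpow_neg, zpow_natCast, ← inv_pow]; norm_num

theorem exp_neg_int_mul_add_pi (n : ℤ) (s : ℝ) :
    Complex.exp (-Complex.I * n * ((s + π : ℝ) : ℂ)) =
      (-1) ^ n.natAbs * Complex.exp (-Complex.I * n * s) := by
  have h : -Complex.I * n * ((s + π : ℝ) : ℂ) =
      ((-n : ℤ) : ℂ) * (π * Complex.I) + -Complex.I * n * s := by
    push_cast; ring
  rw [h, Complex.exp_add, Complex.exp_int_mul, Complex.exp_pi_mul_I, neg_one_pow_natAbs_eq_zpow,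
    zpow_neg, ← inv_zpow]
  norm_num

theorem neg_one_pow_mul_self (m : ℕ) : (-1 : ℂ) ^ m * (-1) ^ m = 1 := by
  rw [← mul_pow]; norm_num

theorem Fc_neg {f : ℝ → ℝ → ℂ} (hper : ∀ s t : ℝ, f (s + 2 * π) t = f s t)
    (heven : ∀ s t : ℝ, f (s + π) (-t) = f s t) (n : ℤ) (t : ℝ) :
    Fc f n (-t) = (-1) ^ n.natAbs * Fc f n t := by
  have hp : Function.Periodic (fun s : ℝ => f s (-t) * Complex.exp (-Complex.I * n * s))
      (2 * π) := fun s => by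
    simp only [hper, exp_neg_int_mul_add_two_pi]
  have h := hp.intervalIntegral_add_eq π 0
  have h2 := intervalIntegral.integral_comp_add_right (a := 0) (b := 2 * π)
    (fun s : ℝ => f s (-t) * Complex.exp (-Complex.I * n * s)) π
  rw [show π + 2 * π = 2 * π + π by ring] at h
  simp only [zero_add] at h h2
  unfold Fc
  rw [← h, ← h2]
  simp only [heven, exp_neg_int_mul_add_pi]
  rw [mul_left_comm, ← intervalIntegral.integral_const_mul ((-1 : ℂ) ^ n.natAbs)]
  congr 1
  refine intervalIntegral.integral_congr fun s _ => ?_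
  ring

theorem Gc_eq_integral_Fc {f : ℝ → ℝ → ℂ} (hcont : Continuous (Function.uncurry f))
    (n : ℤ) (ρ : ℝ) :
    Gc f n ρ = (1 / (2 * π)) * ∫ φ in (0:ℝ)..(2 * π),
      Fc f n (-Real.tan ρ * Real.cos φ) * Complex.exp (-Complex.I * n * φ) := by
  have hc {g h : ℝ × ℝ → ℝ} (hg : Continuous g) (hh : Continuous h) :
      Continuous fun p => f (g p) (h p) := hcont.comp (hg.prodMk hh)
  have key : ∀ F : ℝ → ℝ → ℂ, Continuous (Function.uncurry F) →
      ∫ x in (0:ℝ)..(2 * π), ∫ y in (0:ℝ)..(2 * π), F x y =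
        ∫ y in (0:ℝ)..(2 * π), ∫ x in (0:ℝ)..(2 * π), F x y := fun F hF =>
    intervalIntegral_intervalIntegral_swap <| by
      exact (hF.continuousOn.integrableOn_compact
        (isCompact_uIcc.prod isCompact_uIcc)).mono_set
          (prod_mono uIoc_subset_uIcc uIoc_subset_uIcc)
  unfold Gc RT Fc
  simp only [mul_assoc, intervalIntegral.integral_const_mul]
  simp only [← mul_assoc, ← intervalIntegral.integral_mul_const]
  congr 1
  refine (key _ ?_).trans (Eq.trans (intervalIntegral.integral_congr fun s _ => ?_) (key _ ?_))
  rotate_right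
  · unfold Function.uncurry
    have := hc (g := fun p => p.2) (h := fun p => -Real.tan ρ * Real.cos p.1)
      (by fun_prop) (by fun_prop)
    fun_prop
  · unfold Function.uncurry
    have := hc (g := fun p => p.2) (h := fun p => -Real.tan ρ * Real.cos (p.1 - p.2))
      (by fun_prop) (by fun_prop)
    fun_prop
  have hp : Function.Periodic (fun φ : ℝ => f s (-Real.tan ρ * Real.cos φ) *
      Complex.exp (-Complex.I * n * s) * Complex.exp (-Complex.I * n * φ)) (2 * π) := fun φ => by
    simp only [Real.cos_add_two_pi, exp_neg_int_mul_add_two_pi]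
  have h := hp.intervalIntegral_add_eq (-s) 0
  have h2 := intervalIntegral.integral_comp_sub_right (a := 0) (b := 2 * π)
    (fun φ : ℝ => f s (-Real.tan ρ * Real.cos φ) *
      Complex.exp (-Complex.I * n * s) * Complex.exp (-Complex.I * n * φ)) s
  rw [show -s + 2 * π = 2 * π - s by ring, show -s = 0 - s by ring, ← h2, zero_add] at h
  have hl : ∀ θ : ℝ, f s (-Real.tan ρ * Real.cos (θ - s)) * Complex.exp (-Complex.I * n * s) *
      Complex.exp (-Complex.I * n * ((θ - s : ℝ) : ℂ)) =
      f s (-Real.tan ρ * Real.cos (θ - s)) * Complex.exp (-Complex.I * n * θ) := fun θ => by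
    rw [mul_assoc (f _ _), ← Complex.exp_add]
    congr 2
    push_cast; ring
  simp only [hl] at h
  exact h

theorem Gc_arctan {f : ℝ → ℝ → ℂ} (hcont : Continuous (Function.uncurry f))
    (hper : ∀ s t : ℝ, f (s + 2 * π) t = f s t)
    (heven : ∀ s t : ℝ, f (s + π) (-t) = f s t) (n : ℤ) (x : ℝ) :
    Gc f n (arctan x) = (-1) ^ n.natAbs * ((2 / π : ℝ) *
      ∫ φ in Ioo 0 (π / 2), ((Real.cos (|n| * φ) : ℝ) : ℂ) * Fc f n (x * Real.cos φ)) := by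
  have hF := continuous_Fc hcont n
  set P : ℝ → ℂ := fun φ => Fc f n (x * Real.cos φ) * Complex.exp (-Complex.I * n * φ) with hP
  have hPc : Continuous P := by fun_prop
  have hPi : ∀ a b, IntervalIntegrable P volume a b := fun a b => hPc.intervalIntegrable a b
  have hPp : Function.Periodic P π := fun φ => by
    simp only [hP, Real.cos_add_pi, mul_neg, Fc_neg hper heven, exp_neg_int_mul_add_pi]
    rw [mul_mul_mul_comm, neg_one_pow_mul_self, one_mul]
  have h1 : ∫ φ in (0:ℝ)..(2 * π), P φ = 2 * ∫ φ in (-(π / 2))..(π / 2), P φ := by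
    have e1 := hPp.intervalIntegral_add_eq π 0
    have e2 := hPp.intervalIntegral_add_eq (-(π / 2)) 0
    rw [← intervalIntegral.integral_add_adjacent_intervals (hPi 0 π) (hPi π (2 * π))]
    rw [show π + π = 2 * π by ring, zero_add] at e1
    rw [show -(π / 2) + π = π / 2 by ring, zero_add] at e2
    rw [e1, e2]; ring
  have h2 : ∫ φ in (-(π / 2))..(π / 2), P φ =
      2 * ∫ φ in (0:ℝ)..(π / 2), ((Real.cos (|n| * φ) : ℝ) : ℂ) * Fc f n (x * Real.cos φ) := by
    rw [← intervalIntegral.integral_add_adjacent_intervals (hPi _ 0) (hPi 0 _)]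
    have e := intervalIntegral.integral_comp_neg (a := 0) (b := π / 2) P
    rw [neg_zero] at e
    have hPn : IntervalIntegrable (fun φ => P (-φ)) volume 0 (π / 2) :=
      (hPc.comp continuous_neg).intervalIntegrable _ _
    rw [← e, ← intervalIntegral.integral_add hPn (hPi _ _), ← intervalIntegral.integral_const_mul]
    congr 1
    ext φ
    have hn : Real.cos (|n| * φ) = Real.cos (n * φ) := by
      rcases abs_choice n with h | h <;> rw [h]
      push_cast
      rw [neg_mul, Real.cos_neg]
    simp only [hP, hn, Real.cos_neg]
    rw [← mul_add]
    push_cast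
    rw [Complex.cos]
    rw [show -Complex.I * n * -(φ : ℂ) = n * φ * Complex.I by ring,
      show -Complex.I * n * (φ : ℂ) = -(n * φ) * Complex.I by ring]
    ring
  rw [Gc_eq_integral_Fc hcont, Real.tan_arctan]
  simp only [neg_mul, Fc_neg hper heven, mul_assoc, intervalIntegral.integral_const_mul]
  have h3 : (∫ φ in (0:ℝ)..(2 * π), Fc f n (x * Real.cos φ) *
      Complex.exp (-(Complex.I * (n * φ)))) = ∫ φ in (0:ℝ)..(2 * π), P φ := by
    congr 1; ext φ; simp only [hP]; ring_nf
  rw [h3, h1, h2, intervalIntegral.integral_of_le (by positivity), integral_Ioc_eq_integral_Ioo]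
  have : (π : ℂ) ≠ 0 := by exact_mod_cast Real.pi_ne_zero
  push_cast
  field_simp

open Polynomial.Chebyshev in
theorem integral_re_T_mobius {r : ℝ} (hr0 : 0 ≤ r) (hr1 : r < 1) (m : ℤ) :
    ∫ α in (0:ℝ)..(π / 2), ((T ℂ m).eval ((1 + r * Complex.exp ((2 * α : ℝ) * Complex.I)) /
      (1 - r * Complex.exp ((2 * α : ℝ) * Complex.I)))).re = π / 2 := by
  have hden : ∀ z : ℂ, ‖z‖ ≤ 1 → 1 - r * z ≠ 0 := fun z hz h => by
    have h1 : ‖(r : ℂ) * z‖ = 1 := by rw [← sub_eq_zero.mp h, norm_one]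
    rw [norm_mul, Complex.norm_real, Real.norm_of_nonneg hr0] at h1
    nlinarith [norm_nonneg z]
  set g : ℂ → ℂ := fun z => (T ℂ m).eval ((1 + r * z) / (1 - r * z)) with hg
  have hgd : DifferentiableOn ℂ g (Metric.closedBall 0 |1|) := fun z hz => by
    have hz' : 1 - r * z ≠ 0 := hden z (by simpa using hz)
    have hw : DifferentiableAt ℂ (fun z : ℂ => (1 + r * z) / (1 - r * z)) z :=
      DifferentiableAt.div (by fun_prop) (by fun_prop) hz'
    exact ((T ℂ m).differentiable.differentiableAt.comp z hw).differentiableWithinAt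
  have hexp : ∀ β : ℝ, ‖Complex.exp (β * Complex.I)‖ = 1 := Complex.norm_exp_ofReal_mul_I
  set h : ℝ → ℝ := fun β => (g (Complex.exp (β * Complex.I))).re with hh
  have hgc : Continuous fun β : ℝ => g (Complex.exp (β * Complex.I)) :=
    hgd.continuousOn.comp_continuous (by fun_prop) (by simp [hexp])
  have hhc : Continuous h := Complex.continuous_re.comp hgc
  have hmean : ∫ β in (0:ℝ)..(2 * π), h β = 2 * π := by
    have hav := (DifferentiableOn.diffContOnCl
      (hgd.mono Metric.closure_ball_subset_closedBall)).circleAverage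
    have hg0 : g 0 = 1 := by simp [hg]
    rw [circleAverage_def, hg0, inv_smul_eq_iff₀ (by positivity)] at hav
    have e := (Complex.reCLM.intervalIntegral_comp_comm
      (hgc.intervalIntegrable (μ := volume) 0 (2 * π)))
    simp only [circleMap, zero_add, Complex.ofReal_one, one_mul] at hav
    rw [hav] at e
    simpa using e
  have hsymm : ∀ β, h (2 * π - β) = h β := fun β => by
    have e1 : Complex.exp (((2 * π - β : ℝ) : ℂ) * Complex.I) =
        (starRingEnd ℂ) (Complex.exp (β * Complex.I)) := by
      rw [← Complex.exp_conj]
      rw [show ((2 * π - β : ℝ) : ℂ) * Complex.I =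
        2 * π * Complex.I + (starRingEnd ℂ) (β * Complex.I) by simp; ring,
        Complex.exp_add, Complex.exp_two_pi_mul_I, one_mul]
    have e2 : ∀ z : ℂ, g ((starRingEnd ℂ) z) = (starRingEnd ℂ) (g z) := fun z => by
      have e3 : T ℂ m = (T ℂ m).map (starRingEnd ℂ) := (map_T _ _).symm
      simp only [hg]
      conv_lhs => rw [e3]
      rw [← Polynomial.eval_map_apply]
      simp
    simp only [hh, e1, e2, Complex.conj_re]
  have hhalf : ∫ β in (0:ℝ)..π, h β = π := by
    have e := intervalIntegral.integral_comp_sub_left (a := 0) (b := π) h (2 * π)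
    simp only [hsymm] at e
    rw [show 2 * π - π = π by ring, sub_zero] at e
    have := intervalIntegral.integral_add_adjacent_intervals
      (hhc.intervalIntegrable (μ := volume) 0 π) (hhc.intervalIntegrable (μ := volume) π (2 * π))
    linarith
  have e := intervalIntegral.integral_comp_mul_left (a := 0) (b := π / 2) h (two_ne_zero)
  rw [mul_zero, show 2 * (π / 2) = π by ring, hhalf, smul_eq_mul] at e
  rw [show π / 2 = 2⁻¹ * π by ring] at e ⊢
  exact e

open Polynomial.Chebyshev in
theorem eval_T_cos_mul_eval_T_cosh (m : ℤ) (p q : ℝ) :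
    (T ℝ m).eval (Real.cos p) * (T ℝ m).eval (Real.cosh q) =
      ((T ℂ m).eval ((Real.cos p * Real.cosh q : ℝ) +
        (Real.sin p * Real.sinh q : ℝ) * Complex.I)).re := by
  have e : ((Real.cos p * Real.cosh q : ℝ) + (Real.sin p * Real.sinh q : ℝ) * Complex.I : ℂ) =
      Complex.cos (p + (-q : ℝ) * Complex.I) := by
    rw [Complex.cos_add_mul_I]
    push_cast
    rw [Complex.cosh_neg, Complex.sinh_neg]
    ring
  have e2 : (m : ℂ) * (p + (-q : ℝ) * Complex.I) =
      ((m * p : ℝ) : ℂ) + ((-(m * q) : ℝ) : ℂ) * Complex.I := by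
    push_cast; ring
  rw [e, T_complex_cos, e2, Complex.cos_add_mul_I, T_real_cos, T_real_cosh,
    ← Complex.ofReal_cos, ← Complex.ofReal_sin, ← Complex.ofReal_cosh, ← Complex.ofReal_sinh]
  simp [← Complex.ofReal_mul, -Complex.ofReal_cos, -Complex.ofReal_cosh, -Complex.ofReal_sin,
    -Complex.ofReal_sinh]

open Polynomial.Chebyshev in
theorem eval_T_div_mul_eval_T_div {v t α x : ℝ} (hv : 0 < v) (hvt : v < t) (hα : α ∈ Ioo 0 (π / 2))
    (hx : 0 < x) (hx2 : x ^ 2 = v ^ 2 * Real.cos α ^ 2 + t ^ 2 * Real.sin α ^ 2) (m : ℤ) :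
    (T ℝ m).eval (v / x) * (T ℝ m).eval (t / x) =
      ((T ℂ m).eval ((1 + ((t - v) / (t + v) : ℝ) * Complex.exp ((2 * α : ℝ) * Complex.I)) /
      (1 - ((t - v) / (t + v) : ℝ) * Complex.exp ((2 * α : ℝ) * Complex.I)))).re := by
  have hs : 0 < Real.sin α := Real.sin_pos_of_pos_of_lt_pi hα.1 (by linarith [hα.2, Real.pi_pos])
  have hc : 0 < Real.cos α := Real.cos_pos_of_mem_Ioo ⟨by linarith [hα.1, Real.pi_pos], hα.2⟩
  have hsc := Real.sin_sq_add_cos_sq α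
  have ht : 0 < t := hv.trans hvt
  have hd : 0 < t ^ 2 - v ^ 2 := by nlinarith
  have h1 : x ^ 2 - v ^ 2 = (t ^ 2 - v ^ 2) * Real.sin α ^ 2 := by
    rw [hx2]; linear_combination v ^ 2 * hsc
  have h2 : t ^ 2 - x ^ 2 = (t ^ 2 - v ^ 2) * Real.cos α ^ 2 := by
    rw [hx2]; linear_combination -t ^ 2 * hsc
  have hvx : v < x := by
    have : 0 < x ^ 2 - v ^ 2 := h1 ▸ by positivity
    nlinarith
  have hxt : x < t := by
    have : 0 < t ^ 2 - x ^ 2 := h2 ▸ by positivity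
    nlinarith
  have hvx1 : v / x ≤ 1 := (div_le_one hx).2 hvx.le
  have htx1 : 1 ≤ t / x := (one_le_div hx).2 hxt.le
  have hp : Real.cos (arccos (v / x)) = v / x :=
    Real.cos_arccos (by linarith [div_pos hv hx]) hvx1
  have hq : Real.cosh (arcosh (t / x)) = t / x := Real.cosh_arcosh htx1
  have hsin : Real.sin (arccos (v / x)) * Real.sinh (arcosh (t / x)) =
      (t ^ 2 - v ^ 2) * Real.sin α * Real.cos α / x ^ 2 := by
    rw [Real.sin_arccos, Real.sinh_arcosh htx1, ← Real.sqrt_mul (by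
      rw [sub_nonneg]; exact pow_le_one₀ (by positivity) hvx1)]
    rw [show (1 - (v / x) ^ 2) * ((t / x) ^ 2 - 1) =
      ((t ^ 2 - v ^ 2) * Real.sin α * Real.cos α / x ^ 2) ^ 2 by
        have : (1 - (v / x) ^ 2) * ((t / x) ^ 2 - 1) =
          (x ^ 2 - v ^ 2) * (t ^ 2 - x ^ 2) / x ^ 4 := by field_simp
        rw [this, h1, h2]; field_simp]
    exact Real.sqrt_sq (by positivity)
  have key := eval_T_cos_mul_eval_T_cosh m (arccos (v / x)) (arcosh (t / x))
  rw [hp, hq, hsin] at key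
  rw [key]
  congr 2
  have he : Complex.exp ((2 * α : ℝ) * Complex.I) =
      (Real.cos α + Real.sin α * Complex.I) ^ 2 := by
    rw [Complex.ofReal_cos, Complex.ofReal_sin, ← Complex.exp_mul_I, ← Complex.exp_nat_mul]
    congr 1; push_cast; ring
  have hscC : ((Real.sin α : ℝ) : ℂ) ^ 2 + ((Real.cos α : ℝ) : ℂ) ^ 2 = 1 := by exact_mod_cast hsc
  have hx2C : (x : ℂ) ^ 2 = v ^ 2 * (Real.cos α : ℂ) ^ 2 + t ^ 2 * (Real.sin α : ℂ) ^ 2 := by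
    exact_mod_cast hx2
  have htv : (t : ℂ) + v ≠ 0 := by exact_mod_cast (by positivity : t + v ≠ 0)
  have hxC : (x : ℂ) ≠ 0 := by exact_mod_cast hx.ne'
  rw [he]
  generalize Real.cos α = c at *
  generalize Real.sin α = s at *
  have hI := Complex.I_sq
  have hcs : ((c : ℂ) + s * Complex.I) * (c - s * Complex.I) = 1 := by
    linear_combination hscC - (s : ℂ) ^ 2 * hI
  have hu : ((c : ℂ) + s * Complex.I) ≠ 0 := left_ne_zero_of_mul_eq_one hcs
  have hden : (v : ℂ) * c - t * s * Complex.I ≠ 0 := fun h => by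
    apply pow_ne_zero 2 hxC
    rw [hx2C]
    linear_combination (v * c + t * s * Complex.I) * h + (t * s : ℂ) ^ 2 * hI
  have hnumE : 1 + (((t - v) / (t + v) : ℝ) : ℂ) * ((c : ℂ) + s * Complex.I) ^ 2 =
      2 * (c + s * Complex.I) / (t + v) * (t * c - v * s * Complex.I) := by
    push_cast
    field_simp
    linear_combination (-(t + v) : ℂ) * hcs
  have hdenE : 1 - (((t - v) / (t + v) : ℝ) : ℂ) * ((c : ℂ) + s * Complex.I) ^ 2 =
      2 * (c + s * Complex.I) / (t + v) * (v * c - t * s * Complex.I) := by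
    push_cast
    field_simp
    linear_combination (-(t + v) : ℂ) * hcs
  rw [hnumE, hdenE, mul_div_mul_left _ _ (div_ne_zero (mul_ne_zero two_ne_zero hu) htv), eq_div_iff hden]
  push_cast
  field_simp
  rw [hx2C]
  linear_combination (v * t ^ 2 * s * Complex.I - v ^ 2 * t * c : ℂ) * hscC +
    (v ^ 2 * t * c * s ^ 2 - t ^ 3 * s ^ 2 * c : ℂ) * hI

theorem image_mul_cos_Ioo {r : ℝ} (hr : 0 < r) :
    (fun φ => r * Real.cos φ) '' Ioo 0 (π / 2) = Ioo 0 r := by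
  apply Subset.antisymm
  · rintro _ ⟨φ, hφ, rfl⟩
    have hc : 0 < Real.cos φ :=
      Real.cos_pos_of_mem_Ioo ⟨by linarith [hφ.1, Real.pi_pos], hφ.2⟩
    have hc1 : Real.cos φ < 1 := by
      simpa using Real.cos_lt_cos_of_nonneg_of_le_pi_div_two le_rfl hφ.2.le hφ.1
    exact ⟨by positivity, by nlinarith⟩
  · have h := intermediate_value_Ioo' (f := fun φ => r * Real.cos φ) (a := 0) (b := π / 2)
      (by positivity) (by fun_prop)
    simpa using h

theorem mul_cos_substitution {E : Type*} [NormedAddCommGroup E] [NormedSpace ℝ E] {r : ℝ}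
    (hr : 0 < r) (h : ℝ → E) :
    (∫ v in Ioo 0 r, (1 / √(r ^ 2 - v ^ 2)) • h v = ∫ φ in Ioo 0 (π / 2), h (r * Real.cos φ)) ∧
    (IntegrableOn (fun v => (1 / √(r ^ 2 - v ^ 2)) • h v) (Ioo 0 r) ↔
      IntegrableOn (fun φ => h (r * Real.cos φ)) (Ioo 0 (π / 2))) := by
  have hd : ∀ φ ∈ Ioo 0 (π / 2), HasDerivWithinAt (fun φ => r * Real.cos φ)
      (r * -Real.sin φ) (Ioo 0 (π / 2)) φ := fun φ _ =>
    ((Real.hasDerivAt_cos φ).const_mul r).hasDerivWithinAt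
  have hinj : InjOn (fun φ => r * Real.cos φ) (Ioo 0 (π / 2)) := fun a ha b hb hab =>
    Real.injOn_cos ⟨ha.1.le, by linarith [ha.2, Real.pi_pos]⟩
      ⟨hb.1.le, by linarith [hb.2, Real.pi_pos]⟩ (mul_left_cancel₀ hr.ne' hab)
  have heq : EqOn (fun φ => |r * -Real.sin φ| •
      (1 / √(r ^ 2 - (r * Real.cos φ) ^ 2)) • h (r * Real.cos φ))
      (fun φ => h (r * Real.cos φ)) (Ioo 0 (π / 2)) := fun φ hφ => by
    have hs : 0 < Real.sin φ :=
      Real.sin_pos_of_pos_of_lt_pi hφ.1 (by linarith [hφ.2, Real.pi_pos])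
    have e : r ^ 2 - (r * Real.cos φ) ^ 2 = (r * Real.sin φ) ^ 2 := by
      linear_combination -r ^ 2 * Real.sin_sq_add_cos_sq φ
    have hrs : 0 < r * Real.sin φ := by positivity
    simp only [e]
    rw [Real.sqrt_sq hrs.le, mul_neg, abs_neg, abs_of_pos hrs, smul_smul,
      mul_one_div_cancel hrs.ne', one_smul]
  rw [← image_mul_cos_Ioo hr]
  constructor
  · rw [integral_image_eq_integral_abs_deriv_smul measurableSet_Ioo hd hinj]
    exact setIntegral_congr_fun measurableSet_Ioo heq
  · rw [integrableOn_image_iff_integrableOn_abs_deriv_smul measurableSet_Ioo hd hinj]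
    exact integrableOn_congr_fun heq measurableSet_Ioo

theorem integral_abel_kernel_substitution {v t : ℝ} (hv : 0 < v) (hvt : v < t) (h : ℝ → ℝ) :
    ∫ x in Ioo v t, (1 / √(x ^ 2 - v ^ 2)) * (x / √(t ^ 2 - x ^ 2)) * h x =
      ∫ α in Ioo 0 (π / 2), h (√(v ^ 2 * Real.cos α ^ 2 + t ^ 2 * Real.sin α ^ 2)) := by
  set X : ℝ → ℝ := fun α => √(v ^ 2 * Real.cos α ^ 2 + t ^ 2 * Real.sin α ^ 2) with hX
  have ht : 0 < t := hv.trans hvt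
  have hd0 : 0 < t ^ 2 - v ^ 2 := by nlinarith
  have harg : ∀ α, v ^ 2 * Real.cos α ^ 2 + t ^ 2 * Real.sin α ^ 2 =
      v ^ 2 + (t ^ 2 - v ^ 2) * Real.sin α ^ 2 := fun α => by
    linear_combination v ^ 2 * Real.sin_sq_add_cos_sq α
  have hpos : ∀ α, 0 < v ^ 2 * Real.cos α ^ 2 + t ^ 2 * Real.sin α ^ 2 := fun α => by
    rw [harg]; positivity
  have hX2 : ∀ α, X α ^ 2 = v ^ 2 * Real.cos α ^ 2 + t ^ 2 * Real.sin α ^ 2 := fun α =>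
    Real.sq_sqrt (hpos α).le
  have hXpos : ∀ α, 0 < X α := fun α => Real.sqrt_pos.2 (hpos α)
  have hsin : ∀ α ∈ Ioo 0 (π / 2), 0 < Real.sin α := fun α hα =>
    Real.sin_pos_of_pos_of_lt_pi hα.1 (by linarith [hα.2, Real.pi_pos])
  have hcos : ∀ α ∈ Ioo 0 (π / 2), 0 < Real.cos α := fun α hα =>
    Real.cos_pos_of_mem_Ioo ⟨by linarith [hα.1, Real.pi_pos], hα.2⟩
  have e1 : ∀ α, X α ^ 2 - v ^ 2 = (t ^ 2 - v ^ 2) * Real.sin α ^ 2 := fun α => by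
    rw [hX2, harg]; ring
  have e2 : ∀ α, t ^ 2 - X α ^ 2 = (t ^ 2 - v ^ 2) * Real.cos α ^ 2 := fun α => by
    rw [hX2]; linear_combination -t ^ 2 * Real.sin_sq_add_cos_sq α
  have himg : X '' Ioo 0 (π / 2) = Ioo v t := by
    apply Subset.antisymm
    · rintro _ ⟨α, hα, rfl⟩
      have h1 := hsin α hα
      have h2 := hcos α hα
      have h3 : 0 < X α ^ 2 - v ^ 2 := by rw [e1]; positivity
      have h4 : 0 < t ^ 2 - X α ^ 2 := by rw [e2]; positivity
      have := hXpos α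
      exact ⟨by nlinarith, by nlinarith⟩
    · have h := intermediate_value_Ioo (f := X) (a := 0) (b := π / 2)
        (by positivity) (by fun_prop)
      simpa [hX, Real.sqrt_sq hv.le, Real.sqrt_sq ht.le] using h
  have hinj : InjOn X (Ioo 0 (π / 2)) := fun a ha b hb hab => by
    have h1 : (t ^ 2 - v ^ 2) * Real.sin a ^ 2 = (t ^ 2 - v ^ 2) * Real.sin b ^ 2 := by
      rw [← e1, ← e1, hab]
    have h2 : Real.sin a = Real.sin b :=
      (sq_eq_sq₀ (hsin a ha).le (hsin b hb).le).1 (mul_left_cancel₀ hd0.ne' h1)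
    exact Real.injOn_sin ⟨by linarith [ha.1, Real.pi_pos], ha.2.le⟩
      ⟨by linarith [hb.1, Real.pi_pos], hb.2.le⟩ h2
  have hd : ∀ α ∈ Ioo 0 (π / 2), HasDerivWithinAt X
      ((t ^ 2 - v ^ 2) * Real.sin α * Real.cos α / X α) (Ioo 0 (π / 2)) α := fun α _ => by
    have h1 : HasDerivAt (fun α => v ^ 2 * Real.cos α ^ 2 + t ^ 2 * Real.sin α ^ 2)
        (2 * ((t ^ 2 - v ^ 2) * Real.sin α * Real.cos α)) α := by
      refine ((((Real.hasDerivAt_cos α).pow 2).const_mul (v ^ 2)).add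
        (((Real.hasDerivAt_sin α).pow 2).const_mul (t ^ 2))).congr_deriv ?_
      push_cast; ring
    have h2 := h1.sqrt (hpos α).ne'
    rw [mul_div_mul_left _ _ two_ne_zero] at h2
    exact h2.hasDerivWithinAt
  rw [← himg, integral_image_eq_integral_abs_deriv_smul measurableSet_Ioo hd hinj]
  refine setIntegral_congr_fun measurableSet_Ioo fun α hα => ?_
  have h1 := hsin α hα
  have h2 := hcos α hα
  have h3 := hXpos α
  have h4 : 0 < √(t ^ 2 - v ^ 2) := Real.sqrt_pos.2 hd0
  have h5 : √(t ^ 2 - v ^ 2) ^ 2 = t ^ 2 - v ^ 2 := Real.sq_sqrt hd0.le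
  simp only [e1, e2, smul_eq_mul]
  rw [Real.sqrt_mul hd0.le, Real.sqrt_mul hd0.le, Real.sqrt_sq h1.le, Real.sqrt_sq h2.le,
    abs_of_pos (by positivity)]
  field_simp
  rw [h5]

open Polynomial.Chebyshev in
theorem integral_abel_kernel_T_mul_T {v t : ℝ} (hv : 0 < v) (hvt : v < t) (m : ℤ) :
    ∫ x in Ioo v t, (1 / √(x ^ 2 - v ^ 2)) * (x / √(t ^ 2 - x ^ 2)) *
      ((T ℝ m).eval (v / x) * (T ℝ m).eval (t / x)) = π / 2 := by
  have ht : 0 < t := hv.trans hvt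
  have hmean := integral_re_T_mobius (r := (t - v) / (t + v))
    (div_nonneg (by linarith) (by linarith)) ((div_lt_one (by linarith)).2 (by linarith)) m
  rw [intervalIntegral.integral_of_le (by positivity), integral_Ioc_eq_integral_Ioo] at hmean
  rw [integral_abel_kernel_substitution hv hvt
    (fun x => (T ℝ m).eval (v / x) * (T ℝ m).eval (t / x))]
  refine Eq.trans ?_ hmean
  refine setIntegral_congr_fun measurableSet_Ioo fun α hα => ?_
  have hs : 0 < Real.sin α :=
    Real.sin_pos_of_pos_of_lt_pi hα.1 (by linarith [hα.2, Real.pi_pos])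
  have hpos : 0 < v ^ 2 * Real.cos α ^ 2 + t ^ 2 * Real.sin α ^ 2 := by positivity
  exact eval_T_div_mul_eval_T_div hv hvt hα (Real.sqrt_pos.2 hpos) (Real.sq_sqrt hpos.le) m

open Polynomial.Chebyshev in
theorem eval_T_le_two_mul_pow (m : ℕ) {y : ℝ} (hy : 1 ≤ y) : |(T ℝ m).eval y| ≤ (2 * y) ^ m := by
  have h0 : 0 ≤ (T ℝ m).eval y := by linarith [one_le_eval_T_real (m : ℤ) hy]
  rw [abs_of_nonneg h0, ← Real.cosh_arcosh hy,
    T_real_cosh]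
  have hq := Real.arcosh_nonneg hy
  set q := arcosh y
  have h1 : Real.exp q ≤ 2 * Real.cosh q := by
    rw [Real.cosh_eq]; linarith [Real.exp_pos (-q)]
  have h2 : Real.cosh (m * q) ≤ Real.exp (m * q) := by
    have : Real.exp (-(m * q)) ≤ Real.exp (m * q) :=
      Real.exp_le_exp.2 (neg_le_self (by positivity))
    rw [Real.cosh_eq]; linarith
  push_cast
  calc Real.cosh (m * q) ≤ Real.exp (m * q) := h2
    _ = Real.exp q ^ m := by rw [Real.exp_nat_mul]
    _ ≤ (2 * Real.cosh q) ^ m := pow_le_pow_left₀ (Real.exp_pos q).le h1 m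

open Polynomial.Chebyshev in
/-- The inversion kernel `T_m(t/x) x / √(t² - x²)`. -/
noncomputable def cormackKernel (m : ℤ) (t x : ℝ) : ℝ :=
  (T ℝ m).eval (t / x) * x / √(t ^ 2 - x ^ 2)

open Polynomial.Chebyshev in
/-- The double integrand of the inversion formula, before exchanging the integrals. -/
noncomputable def cormackIntegrand (F : ℝ → ℂ) (m : ℤ) (t x v : ℝ) : ℂ :=
  (1 / √(x ^ 2 - v ^ 2)) • (((T ℝ m).eval (v / x) * cormackKernel m t x : ℝ) : ℂ) * F v

theorem abs_cormackKernel_mul_pow_le (m : ℕ) {t x : ℝ} (hx : 0 < x) (hxt : x < t) :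
    x ^ (m - 1) * |cormackKernel m t x| ≤ (t + (2 * t) ^ m) * (1 / √(t ^ 2 - x ^ 2)) := by
  have ht : 0 < t := hx.trans hxt
  have hT := eval_T_le_two_mul_pow m ((one_le_div hx).2 hxt.le)
  rw [cormackKernel, abs_div, abs_mul, abs_of_pos hx, abs_of_nonneg (Real.sqrt_nonneg _),
    ← mul_div_assoc, mul_one_div]
  gcongr
  calc _ ≤ x ^ (m - 1) * ((2 * (t / x)) ^ m * x) := by gcongr
    _ ≤ _ := by
      rcases m with _ | k
      · simp; linarith
      · have : x ^ (k + 1 - 1) * ((2 * (t / x)) ^ (k + 1) * x) = (2 * t) ^ (k + 1) := by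
          rw [Nat.add_sub_cancel, ← mul_div_assoc, div_pow]
          field_simp
          ring
        rw [this]; linarith

theorem measurable_cormackKernel (m : ℤ) (t : ℝ) : Measurable (cormackKernel m t) := by
  unfold cormackKernel
  have := (Polynomial.Chebyshev.T ℝ m).continuous.measurable.comp
    (measurable_const.div measurable_id : Measurable fun x : ℝ => t / x)
  exact (this.mul measurable_id).div (by fun_prop)

theorem measurable_cormackIntegrand {F : ℝ → ℂ} (hF : Continuous F) (m : ℤ) (t : ℝ) :
    Measurable (Function.uncurry (cormackIntegrand F m t)) := by
  have h1 := (Polynomial.Chebyshev.T ℝ m).continuous.measurable.comp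
    (measurable_snd.div measurable_fst : Measurable fun p : ℝ × ℝ => p.2 / p.1)
  have h2 := (measurable_cormackKernel m t).comp
    (measurable_fst : Measurable (Prod.fst : ℝ × ℝ → ℝ))
  have h3 : Measurable fun p : ℝ × ℝ => 1 / √(p.1 ^ 2 - p.2 ^ 2) := by fun_prop
  exact (h3.smul (Complex.measurable_ofReal.comp (h1.mul h2))).mul
    (hF.measurable.comp measurable_snd)

theorem cormackIntegrand_substitution (F : ℝ → ℂ) (m : ℤ) (t : ℝ) {x : ℝ} (hx : 0 < x) :
    ∫ v in Ioo 0 x, cormackIntegrand F m t x v =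
      (∫ φ in Ioo 0 (π / 2), ((Real.cos (m * φ) : ℝ) : ℂ) * F (x * Real.cos φ)) *
        (cormackKernel m t x : ℂ) := by
  simp only [cormackIntegrand, smul_mul_assoc]
  rw [(mul_cos_substitution hx fun v =>
    (((Polynomial.Chebyshev.T ℝ m).eval (v / x) * cormackKernel m t x : ℝ) : ℂ) * F v).1,
    ← integral_mul_const]
  congr 1
  ext φ
  rw [mul_div_cancel_left₀ _ hx.ne', Polynomial.Chebyshev.T_real_cos]
  push_cast
  ring

theorem integrableOn_cormackIntegrand {F : ℝ → ℂ} (hF : Continuous F) (m : ℤ) (t : ℝ) {x : ℝ}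
    (hx : 0 < x) : IntegrableOn (cormackIntegrand F m t x) (Ioo 0 x) := by
  have h := (mul_cos_substitution hx fun v =>
    (((Polynomial.Chebyshev.T ℝ m).eval (v / x) * cormackKernel m t x : ℝ) : ℂ) * F v).2
  simp only [← smul_mul_assoc] at h
  refine h.2 ?_
  have : Continuous fun φ => (((Polynomial.Chebyshev.T ℝ m).eval (x * Real.cos φ / x) *
      cormackKernel m t x : ℝ) : ℂ) * F (x * Real.cos φ) := by fun_prop
  exact (this.integrableOn_Icc (a := 0) (b := π / 2)).mono_set Ioo_subset_Icc_self

theorem integral_norm_cormackIntegrand_le {F : ℝ → ℂ} (hF : Continuous F) (m : ℕ) {t x C : ℝ}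
    (hC : 0 ≤ C) (hb : ∀ v ∈ Ioo 0 t, ‖F v‖ ≤ C * v ^ (m - 1)) (hx : x ∈ Ioo 0 t) :
    ∫ v in Ioo 0 x, ‖cormackIntegrand F m t x v‖ ≤
      π / 2 * (C * ((t + (2 * t) ^ m) * (1 / √(t ^ 2 - x ^ 2)))) := by
  obtain ⟨hx0, hxt⟩ := hx
  simp only [cormackIntegrand, norm_smul, norm_mul, mul_assoc, Complex.norm_real]
  have e := (mul_cos_substitution hx0 fun v => ‖(Polynomial.Chebyshev.T ℝ m).eval (v / x)‖ *
    (‖cormackKernel m t x‖ * ‖F v‖)).1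
  simp only [smul_eq_mul] at e
  have hn : ∀ v, ‖1 / √(x ^ 2 - v ^ 2)‖ = 1 / √(x ^ 2 - v ^ 2) := fun v =>
    Real.norm_of_nonneg (by positivity)
  simp only [hn]
  rw [e]
  have hbound : ∀ φ ∈ Ioo 0 (π / 2), ‖(Polynomial.Chebyshev.T ℝ m).eval (x * Real.cos φ / x)‖ *
      (‖cormackKernel m t x‖ * ‖F (x * Real.cos φ)‖) ≤
      C * ((t + (2 * t) ^ m) * (1 / √(t ^ 2 - x ^ 2))) := fun φ hφ => by
    have hc : 0 < Real.cos φ := Real.cos_pos_of_mem_Ioo ⟨by linarith [hφ.1, Real.pi_pos], hφ.2⟩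
    have hxc : x * Real.cos φ ≤ x := mul_le_of_le_one_right hx0.le (Real.cos_le_one φ)
    rw [mul_div_cancel_left₀ _ hx0.ne', Polynomial.Chebyshev.T_real_cos]
    calc _ ≤ 1 * (‖cormackKernel m t x‖ * (C * x ^ (m - 1))) := by
          gcongr
          · exact Real.abs_cos_le_one _
          · exact (hb _ ⟨by positivity, by linarith⟩).trans (by gcongr)
      _ = C * (x ^ (m - 1) * |cormackKernel m t x|) := by rw [Real.norm_eq_abs]; ring
      _ ≤ _ := mul_le_mul_of_nonneg_left (abs_cormackKernel_mul_pow_le m hx0 hxt) hC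
  have hcont : Continuous fun φ => ‖(Polynomial.Chebyshev.T ℝ m).eval (x * Real.cos φ / x)‖ *
      (‖cormackKernel m t x‖ * ‖F (x * Real.cos φ)‖) := by fun_prop
  calc _ ≤ ∫ φ in Ioo 0 (π / 2), C * ((t + (2 * t) ^ m) * (1 / √(t ^ 2 - x ^ 2))) :=
        setIntegral_mono_on
          ((hcont.integrableOn_Icc (a := 0) (b := π / 2)).mono_set Ioo_subset_Icc_self)
          (integrableOn_const (by simp)) measurableSet_Ioo hbound
    _ = _ := by
        rw [setIntegral_const, measureReal_def, Real.volume_Ioo,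
          ENNReal.toReal_ofReal (by linarith [Real.pi_pos]), smul_eq_mul, sub_zero]

theorem cormack_inversion {F : ℝ → ℂ} (hF : Continuous F) (m : ℕ) {t C : ℝ} (ht : 0 < t)
    (hC : 0 ≤ C) (hb : ∀ v ∈ Ioo 0 t, ‖F v‖ ≤ C * v ^ (m - 1)) :
    IntegrableOn (fun x => (∫ φ in Ioo 0 (π / 2), ((Real.cos ((m : ℤ) * φ) : ℝ) : ℂ) *
      F (x * Real.cos φ)) * (cormackKernel m t x : ℂ)) (Ioo 0 t) ∧
    ∫ x in Ioo 0 t, (∫ φ in Ioo 0 (π / 2), ((Real.cos ((m : ℤ) * φ) : ℝ) : ℂ) *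
      F (x * Real.cos φ)) * (cormackKernel m t x : ℂ) = (π / 2 : ℝ) * ∫ v in Ioo 0 t, F v := by
  set H : ℝ → ℝ → ℂ := fun x v => (Iio x).indicator (cormackIntegrand F m t x) v with hH
  have hrow : ∀ x ∈ Ioo 0 t, Ioo 0 t ∩ Iio x = Ioo 0 x := fun x hx => by
    ext v; simp only [mem_inter_iff, mem_Ioo, mem_Iio]
    exact ⟨fun h => ⟨h.1.1, h.2⟩, fun h => ⟨⟨h.1, h.2.trans hx.2⟩, h.2⟩⟩
  have hcol : ∀ v ∈ Ioo 0 t, Ioo 0 t ∩ Ioi v = Ioo v t := fun v hv => by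
    ext x; simp only [mem_inter_iff, mem_Ioo, mem_Ioi]
    exact ⟨fun h => ⟨h.2, h.1.2⟩, fun h => ⟨⟨hv.1.trans h.1, h.2⟩, h.1⟩⟩
  have hHm : Measurable (Function.uncurry H) := by
    have : Function.uncurry H =
        {p : ℝ × ℝ | p.2 < p.1}.indicator (Function.uncurry (cormackIntegrand F m t)) := by
      ext ⟨x, v⟩
      simp [hH, indicator, Function.uncurry]
    rw [this]
    exact (measurable_cormackIntegrand hF m t).indicator
      (measurableSet_lt measurable_snd measurable_fst)
  have hHint : Integrable (Function.uncurry H)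
      ((volume.restrict (Ioo 0 t)).prod (volume.restrict (Ioo 0 t))) := by
    rw [integrable_prod_iff hHm.aestronglyMeasurable]
    refine ⟨ae_restrict_of_forall_mem measurableSet_Ioo fun x hx => ?_, ?_⟩
    · change Integrable ((Iio x).indicator (cormackIntegrand F m t x)) _
      rw [integrable_indicator_iff measurableSet_Iio, IntegrableOn,
        Measure.restrict_restrict measurableSet_Iio, inter_comm, hrow x hx]
      exact integrableOn_cormackIntegrand hF m t hx.1
    · have hdom : IntegrableOn (fun x => (1 / √(t ^ 2 - x ^ 2)) • (1 : ℝ)) (Ioo 0 t) :=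
        (mul_cos_substitution ht fun _ => (1 : ℝ)).2.2 (integrableOn_const (by simp))
      simp only [smul_eq_mul, mul_one] at hdom
      refine Integrable.mono'
        (((hdom.const_mul (t + (2 * t) ^ m)).const_mul C).const_mul (π / 2))
        hHm.norm.stronglyMeasurable.integral_prod_right'.aestronglyMeasurable
        (ae_restrict_of_forall_mem measurableSet_Ioo fun x hx => ?_)
      rw [Real.norm_of_nonneg (integral_nonneg fun _ => norm_nonneg _)]
      change ∫ v in Ioo 0 t, ‖(Iio x).indicator (cormackIntegrand F m t x) v‖ ≤ _
      simp only [norm_indicator_eq_indicator_norm]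
      rw [setIntegral_indicator measurableSet_Iio, hrow x hx]
      exact integral_norm_cormackIntegrand_le hF m hC hb hx
  have hinner : ∀ x ∈ Ioo 0 t, ∫ v in Ioo 0 t, H x v =
      (∫ φ in Ioo 0 (π / 2), ((Real.cos ((m : ℤ) * φ) : ℝ) : ℂ) * F (x * Real.cos φ)) *
        (cormackKernel m t x : ℂ) := fun x hx => by
    simp only [hH]
    rw [setIntegral_indicator measurableSet_Iio, hrow x hx,
      cormackIntegrand_substitution F m t hx.1]
  have houter : ∀ v ∈ Ioo 0 t, ∫ x in Ioo 0 t, H x v = (π / 2 : ℝ) * F v := fun v hv => by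
    have : ∀ x, H x v = (Ioi v).indicator (fun x => cormackIntegrand F m t x v) x := fun x => by
      simp [hH, indicator]
    simp only [this]
    rw [setIntegral_indicator measurableSet_Ioi, hcol v hv,
      ← integral_abel_kernel_T_mul_T hv.1 hv.2 m, ← integral_complex_ofReal, ← integral_mul_const]
    congr 1
    ext x
    rw [cormackIntegrand, cormackKernel, Complex.real_smul, ← Complex.ofReal_mul]
    congr 2
    ring
  constructor
  · exact IntegrableOn.congr_fun hHint.integral_prod_left hinner measurableSet_Ioo
  · rw [← setIntegral_congr_fun measurableSet_Ioo hinner, integral_integral_swap hHint,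
      setIntegral_congr_fun measurableSet_Ioo houter, integral_const_mul]

theorem exists_norm_le_mul_pow {F : ℝ → ℂ} (hF : Continuous F) (k : ℕ) {ε c t : ℝ} (hε : 0 < ε)
    (hc : 0 ≤ c) (hsmall : ∀ v, |v| < ε → ‖F v‖ ≤ c * |v| ^ k) :
    ∃ C, 0 ≤ C ∧ ∀ v ∈ Ioo 0 t, ‖F v‖ ≤ C * v ^ k := by
  obtain ⟨M, hM⟩ := (isCompact_Icc (a := (0:ℝ)) (b := t)).exists_bound_of_continuousOn
    hF.continuousOn
  have hq : 0 ≤ |M| / ε ^ k := by positivity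
  refine ⟨c + |M| / ε ^ k, by positivity, fun v hv => ?_⟩
  have hvk : 0 ≤ v ^ k := pow_nonneg hv.1.le k
  rcases lt_or_ge v ε with h | h
  · have := hsmall v (by rwa [abs_of_pos hv.1])
    rw [abs_of_pos hv.1] at this
    nlinarith [mul_nonneg hq hvk]
  · have h1 : |M| ≤ |M| / ε ^ k * v ^ k := by
      rw [div_mul_eq_mul_div, le_div_iff₀ (by positivity)]
      gcongr
    nlinarith [hM v (Ioo_subset_Icc_self hv), le_abs_self M, mul_nonneg hc hvk]

/-- absolute convergence and evaluation of the inversion integral. -/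
theorem statement4 (f : ℝ → ℝ → ℂ)
    (hcont : Continuous (Function.uncurry f))
    (hper : ∀ s t : ℝ, f (s + 2 * π) t = f s t)
    (heven : ∀ s t : ℝ, f (s + π) (-t) = f s t)
    (ε : ℝ) (hε : 0 < ε) (C : ℤ → ℝ) (hC : ∀ n : ℤ, 0 < C n)
    (hF0 : ∀ t : ℝ, |t| < ε → ‖Fc f 0 t‖ ≤ C 0)
    (hFn : ∀ n : ℤ, n ≠ 0 → ∀ t : ℝ, |t| < ε → ‖Fc f n t‖ ≤ C n * |t| ^ (n.natAbs - 1)) :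
    ∀ n : ℤ, ∀ t : ℝ, 0 < t →
      IntegrableOn (fun x : ℝ => Gc f n (Real.arctan x) *
          (((Polynomial.Chebyshev.T ℝ |n|).eval (t / x) * x / Real.sqrt (t ^ 2 - x ^ 2) : ℝ) : ℂ))
        (Set.Ioc (0:ℝ) t) ∧
      (-1) ^ n.natAbs *
          ∫ x in (0:ℝ)..t, Gc f n (Real.arctan x) *
            (((Polynomial.Chebyshev.T ℝ |n|).eval (t / x) * x / Real.sqrt (t ^ 2 - x ^ 2) : ℝ) : ℂ)
        = ∫ u in (0:ℝ)..t, Fc f n u := by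
  intro n t ht
  have hF := continuous_Fc hcont n
  obtain ⟨c, hc, hb⟩ := exists_norm_le_mul_pow (t := t) hF (n.natAbs - 1) hε (hC n).le
    fun v hv => by
      rcases eq_or_ne n 0 with rfl | hn
      · simpa using hF0 v hv
      · exact hFn n hn v hv
  obtain ⟨hint, hval⟩ := cormack_inversion hF n.natAbs ht hc hb
  simp only [Int.natCast_natAbs] at hint hval
  have hform : ∀ x : ℝ, Gc f n (Real.arctan x) *
      (((Polynomial.Chebyshev.T ℝ |n|).eval (t / x) * x / Real.sqrt (t ^ 2 - x ^ 2) : ℝ) : ℂ) =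
      (-1) ^ n.natAbs * (2 / π : ℝ) * ((∫ φ in Ioo 0 (π / 2), ((Real.cos (|n| * φ) : ℝ) : ℂ) *
        Fc f n (x * Real.cos φ)) * (cormackKernel |n| t x : ℂ)) := fun x => by
    rw [Gc_arctan hcont hper heven, cormackKernel]
    ring
  simp only [hform]
  constructor
  · rw [integrableOn_Ioc_iff_integrableOn_Ioo]
    exact hint.const_mul _
  · rw [intervalIntegral.integral_of_le ht.le, intervalIntegral.integral_of_le ht.le,
      integral_Ioc_eq_integral_Ioo, integral_Ioc_eq_integral_Ioo, integral_const_mul, hval,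
      ← mul_assoc, ← mul_assoc, ← mul_assoc, neg_one_pow_mul_self, one_mul, ← Complex.ofReal_mul,
      show 2 / π * (π / 2) = 1 by field_simp, Complex.ofReal_one, one_mul]
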